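/- For each 2 ≤ k ≤ p, the set I_k = {a ∈ A₁^{⊗k} : a·b = 0 for all b ∈ A₁^{⊗(p+1−k)}} coincides with the set {a ∈ A₁^{⊗k} : b·a = 0 for all b ∈ A₁^{⊗(p+1−k)}}; i.e. the defining condition of I_k from the right is equivalent to the analogous condition from the left. -/

import Mathlib

open scoped TensorProduct DirectSum

noncomputable section

/-- The pure tensor `a₀ ⊗ a₁ ⊗ ⋯ ⊗ a_{m-1}` in the `m`-th tensor power. -/
def tp (A : Type) [AddCommGroup A] [Module ℂ A] (m : ℕ) (a : ℕ → A) : ⨂[ℂ]^m A :=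
  PiTensorProduct.tprod ℂ (fun i : Fin m => a i.1)

/-- The space `M = ⊕_{k=1}^{p} A₁^{⊗k}`; the component of index `k : Fin p` is the
tensor power of degree `k + 1`. -/
abbrev Mspace (p : ℕ) (A : Type) [AddCommGroup A] [Module ℂ A] : Type :=
  ⨁ k : Fin p, ⨂[ℂ]^(k.1 + 1) A

/-- Inclusion of the degree-`(k+1)` homogeneous component into `M`. -/
def incl (p : ℕ) (A : Type) [AddCommGroup A] [Module ℂ A] (k : Fin p) :
    (⨂[ℂ]^(k.1 + 1) A) →ₗ[ℂ] Mspace p A :=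
  DirectSum.lof ℂ (Fin p) (fun k : Fin p => ⨂[ℂ]^(k.1 + 1) A) k

/-- The one-step substitution `id^{⊗r} ⊗ Γ ⊗ id^{⊗(n-2-r)}` followed by `Γ`, evaluated on
a family of `2n−3` arguments; used to state the general associativity condition. -/
def gammaIns (n : ℕ) (A : Type) [AddCommGroup A] [Module ℂ A]
    (Γ : MultilinearMap ℂ (fun _ : Fin (n - 1) => A) A) (r : ℕ) (a : ℕ → A) : A :=
  Γ (fun i : Fin (n - 1) =>
    if i.1 < r then a i.1
    else if i.1 = r then Γ (fun j : Fin (n - 1) => a (r + j.1))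
    else a (i.1 + (n - 2)))

/-- `mul` is the bilinear multiplication of `M = ⊕_{k=1}^{p} A₁^{⊗k}` determined on
homogeneous pure tensors `a = a₁⊗⋯⊗a_k`, `b = b₁⊗⋯⊗b_l` by: `a·b = a ⊗ b` if
`k + l ≤ p`, and `a·b = Γ(a₁,…,a_k,b₁,…,b_{p+1−k}) ⊗ b_{p+2−k} ⊗ ⋯ ⊗ b_l` if
`k + l > p`. -/
def MulSpec (n p : ℕ) (A : Type) [AddCommGroup A] [Module ℂ A]
    (Γ : MultilinearMap ℂ (fun _ : Fin (n - 1) => A) A)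
    (mul : Mspace p A →ₗ[ℂ] Mspace p A →ₗ[ℂ] Mspace p A) : Prop :=
  ∀ (k l : Fin p) (a b : ℕ → A),
    mul (incl p A k (tp A (k.1 + 1) a)) (incl p A l (tp A (l.1 + 1) b)) =
      if h : (k.1 + 1) + (l.1 + 1) ≤ p then
        incl p A ⟨k.1 + l.1 + 1, by omega⟩
          (tp A (k.1 + l.1 + 1 + 1)
            (fun i => if i < k.1 + 1 then a i else b (i - (k.1 + 1))))
      else
        incl p A ⟨k.1 + l.1 + 1 - p, by have := k.isLt; have := l.isLt; omega⟩
          (tp A (k.1 + l.1 + 1 - p + 1)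
            (fun i =>
              if i = 0 then
                Γ (fun j : Fin (n - 1) =>
                  if j.1 < k.1 + 1 then a j.1 else b (j.1 - (k.1 + 1)))
              else b (p - (k.1 + 1) + i)))

/-- The subspace `I_k ⊆ A₁^{⊗k}`: `I₁ = {0}`, and for `2 ≤ k ≤ p`,
`I_k = {a : a·b = 0 for all b ∈ A₁^{⊗(p+1−k)}}`.  (The component of index `k : Fin p`
has degree `k + 1`.) -/
def Ik (p : ℕ) (A : Type) [AddCommGroup A] [Module ℂ A]
    (mul : Mspace p A →ₗ[ℂ] Mspace p A →ₗ[ℂ] Mspace p A) (k : Fin p) :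
    Submodule ℂ (⨂[ℂ]^(k.1 + 1) A) :=
  if k.1 = 0 then ⊥
  else
    ⨅ y : ⨂[ℂ]^(p - (k.1 + 1) + 1) A,
      LinearMap.ker
        ((mul.flip (incl p A ⟨p - (k.1 + 1), by have := k.isLt; omega⟩ y)).comp (incl p A k))

/-- The subspace `I = ⊕_{k=1}^{p} I_k ⊆ M`. -/
def Isub (p : ℕ) (A : Type) [AddCommGroup A] [Module ℂ A]
    (mul : Mspace p A →ₗ[ℂ] Mspace p A →ₗ[ℂ] Mspace p A) : Submodule ℂ (Mspace p A) :=
  ⨆ k : Fin p, (Ik p A mul k).map (incl p A k)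

/-- `qM` is the bilinear form on `M` determined on homogeneous pure tensors
`a ∈ A₁^{⊗k}`, `b ∈ A₁^{⊗l}` by: `q(a,b) = 0` if `k + l ≢ 2 mod p`;
`q(a,b) = q₁(a₁, Γ(a₂,…,a_k,b₁,…,b_l))` if `k + l = n`; and `q(a,b) = q₁(a₁,b₁)` if
`k = l = 1`. -/
def QSpec (n p : ℕ) (A : Type) [AddCommGroup A] [Module ℂ A]
    (Γ : MultilinearMap ℂ (fun _ : Fin (n - 1) => A) A)
    (q₁ : A →ₗ[ℂ] A →ₗ[ℂ] ℂ)
    (qM : Mspace p A →ₗ[ℂ] Mspace p A →ₗ[ℂ] ℂ) : Prop :=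
  ∀ (k l : Fin p) (a b : ℕ → A),
    qM (incl p A k (tp A (k.1 + 1) a)) (incl p A l (tp A (l.1 + 1) b)) =
      if ((k.1 + 1) + (l.1 + 1)) % p = 2 % p then
        (if (k.1 + 1) + (l.1 + 1) = n then
          q₁ (a 0) (Γ (fun j : Fin (n - 1) =>
            if j.1 + 1 < k.1 + 1 then a (j.1 + 1) else b (j.1 + 1 - (k.1 + 1))))
        else q₁ (a 0) (b 0))
      else 0

/-- Inclusion of `A` as the degree-one part. -/
def iotaA (p : ℕ) (hp : 0 < p) (A : Type) [AddCommGroup A] [Module ℂ A] (v : A) : Mspace p A :=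
  incl p A ⟨0, hp⟩ (tp A 1 (fun _ => v))

instance subFin01 : Subsingleton (Fin (0 + 1)) := inferInstanceAs (Subsingleton (Fin 1))

/-- Projection to the degree-one part. -/
def piA (p : ℕ) (hp : 0 < p) (A : Type) [AddCommGroup A] [Module ℂ A] : Mspace p A →ₗ[ℂ] A :=
  (PiTensorProduct.lift
    (MultilinearMap.ofSubsingleton ℂ A A (0 : Fin (0 + 1)) LinearMap.id)).comp
    (DirectSum.component ℂ (Fin p) (fun k : Fin p => ⨂[ℂ]^(k.1 + 1) A) ⟨0, hp⟩)

lemma piA_iotaA (p : ℕ) (hp : 0 < p) (A : Type) [AddCommGroup A] [Module ℂ A] (v : A) :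
    piA p hp A (iotaA p hp A v) = v := by
  unfold piA iotaA incl tp
  rw [LinearMap.comp_apply, DirectSum.component.lof_self]
  erw [PiTensorProduct.lift.tprod]
  simp

/-- The degree-one inclusion is linear. -/
def iotaL (p : ℕ) (hp : 0 < p) (A : Type) [AddCommGroup A] [Module ℂ A] : A →ₗ[ℂ] Mspace p A :=
  (incl p A ⟨0, hp⟩).comp
    ((MultilinearMap.ofSubsingleton ℂ A (⨂[ℂ]^(0 + 1) A) (0 : Fin (0 + 1))).symm
      (PiTensorProduct.tprod ℂ))

lemma iotaL_apply (p : ℕ) (hp : 0 < p) (A : Type) [AddCommGroup A] [Module ℂ A] (v : A) :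
    iotaL p hp A v = iotaA p hp A v := rfl

lemma incl_zero (p : ℕ) (hp : 0 < p) (A : Type) [AddCommGroup A] [Module ℂ A] (i : ℕ)
    (hi : i < p) (h0 : i = 0) (f : ℕ → A) :
    incl p A ⟨i, hi⟩ (tp A (i + 1) f) = iotaA p hp A (f 0) := by
  subst h0
  unfold iotaA
  congr 1
  unfold tp
  congr 1
  ext j
  have : j.1 = 0 := by omega
  simp

lemma tprod_eq_tp (A : Type) [AddCommGroup A] [Module ℂ A] (m : ℕ) (f : Fin m → A) :
    PiTensorProduct.tprod ℂ f = tp A m (fun j => if h : j < m then f ⟨j, h⟩ else 0) := by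
  unfold tp
  congr 1
  ext j
  simp

lemma lin_ext (A B : Type) [AddCommGroup A] [Module ℂ A] [AddCommGroup B] [Module ℂ B] (m : ℕ)
    (F G : (⨂[ℂ]^m A) →ₗ[ℂ] B) (h : ∀ a : ℕ → A, F (tp A m a) = G (tp A m a)) (x : ⨂[ℂ]^m A) :
    F x = G x := by
  have : F = G := by
    apply PiTensorProduct.ext
    ext f
    simp only [LinearMap.compMultilinearMap_apply]
    rw [tprod_eq_tp]
    exact h _
  rw [this]

lemma mul_pure (n p : ℕ) (hn : 3 ≤ n) (hp : p = n - 2) (hp0 : 0 < p)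
    (A : Type) [AddCommGroup A] [Module ℂ A]
    (Γ : MultilinearMap ℂ (fun _ : Fin (n - 1) => A) A)
    (mul : Mspace p A →ₗ[ℂ] Mspace p A →ₗ[ℂ] Mspace p A)
    (hmul : MulSpec n p A Γ mul) (k l : Fin p) (hkl : k.1 + l.1 + 1 = p) (a b : ℕ → A) :
    mul (incl p A k (tp A (k.1 + 1) a)) (incl p A l (tp A (l.1 + 1) b)) =
      iotaA p hp0 A (Γ (fun j : Fin (n - 1) =>
                  if j.1 < k.1 + 1 then a j.1 else b (j.1 - (k.1 + 1)))) := by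
  rw [hmul, dif_neg (by omega), incl_zero p hp0 A _ _ (by omega)]
  simp

lemma mul_iota_pi (n p : ℕ) (hn : 3 ≤ n) (hp : p = n - 2) (hp0 : 0 < p)
    (A : Type) [AddCommGroup A] [Module ℂ A]
    (Γ : MultilinearMap ℂ (fun _ : Fin (n - 1) => A) A)
    (mul : Mspace p A →ₗ[ℂ] Mspace p A →ₗ[ℂ] Mspace p A)
    (hmul : MulSpec n p A Γ mul) (k l : Fin p) (hkl : k.1 + l.1 + 1 = p)
    (x : ⨂[ℂ]^(k.1 + 1) A) (y : ⨂[ℂ]^(l.1 + 1) A) :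
    mul (incl p A k x) (incl p A l y) =
      iotaL p hp0 A (piA p hp0 A (mul (incl p A k x) (incl p A l y))) := by
  refine lin_ext A _ _ ((mul (incl p A k x)).comp (incl p A l))
    ((iotaL p hp0 A).comp ((piA p hp0 A).comp ((mul (incl p A k x)).comp (incl p A l)))) ?_ y
  intro b
  refine lin_ext A _ _ ((mul.flip (incl p A l (tp A _ b))).comp (incl p A k))
    ((iotaL p hp0 A).comp
      ((piA p hp0 A).comp ((mul.flip (incl p A l (tp A _ b))).comp (incl p A k)))) ?_ x
  intro a
  simp only [LinearMap.comp_apply, LinearMap.flip_apply]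
  rw [mul_pure n p hn hp hp0 A Γ mul hmul k l hkl, piA_iotaA, iotaL_apply]

lemma rot (n : ℕ) (hn : 3 ≤ n)
    (A : Type) [AddCommGroup A] [Module ℂ A]
    (Γ : MultilinearMap ℂ (fun _ : Fin (n - 1) => A) A)
    (q₁ : A →ₗ[ℂ] A →ₗ[ℂ] ℂ)
    (hq₁symm : ∀ x y : A, q₁ x y = q₁ y x)
    (hinv : ∀ a : ℕ → A,
      q₁ (Γ (fun i : Fin (n - 1) => a i.1)) (a (n - 1)) =
        q₁ (a 0) (Γ (fun i : Fin (n - 1) => a (i.1 + 1)))) (f : ℕ → A) (m : ℕ) :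
    q₁ (Γ (fun i : Fin (n - 1) => f i.1)) (f (n - 1)) =
      q₁ (Γ (fun i : Fin (n - 1) => f ((i.1 + m) % n))) (f ((n - 1 + m) % n)) := by
  induction m with
  | zero =>
    rw [Nat.add_zero, Nat.mod_eq_of_lt (by omega : n - 1 < n)]
    congr 3
    ext i
    rw [Nat.add_zero, Nat.mod_eq_of_lt (by omega)]
  | succ m ih =>
    rw [ih, hinv (fun i => f ((i + m) % n)), hq₁symm]
    have e : n - 1 + (m + 1) = 0 + m + n := by omega
    rw [e, Nat.add_mod_right]
    congr 4
    ext i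
    congr 2
    omega

lemma rot' (n : ℕ) (hn : 3 ≤ n)
    (A : Type) [AddCommGroup A] [Module ℂ A]
    (Γ : MultilinearMap ℂ (fun _ : Fin (n - 1) => A) A)
    (q₁ : A →ₗ[ℂ] A →ₗ[ℂ] ℂ)
    (hq₁symm : ∀ x y : A, q₁ x y = q₁ y x)
    (hinv : ∀ a : ℕ → A,
      q₁ (Γ (fun i : Fin (n - 1) => a i.1)) (a (n - 1)) =
        q₁ (a 0) (Γ (fun i : Fin (n - 1) => a (i.1 + 1)))) (f g : ℕ → A) (m : ℕ) (hm : m < n)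
    (h1 : ∀ i, i + m < n → g i = f (i + m))
    (h2 : ∀ i, i < n → n ≤ i + m → g i = f (i + m - n)) :
    q₁ (Γ (fun i : Fin (n - 1) => f i.1)) (f (n - 1)) =
      q₁ (Γ (fun i : Fin (n - 1) => g i.1)) (g (n - 1)) := by
  have key : ∀ i, i < n → f ((i + m) % n) = g i := by
    intro i hi
    by_cases h : i + m < n
    · rw [h1 i h, Nat.mod_eq_of_lt h]
    · rw [h2 i hi (by omega), Nat.mod_eq_sub_mod (by omega), Nat.mod_eq_of_lt (by omega)]
  rw [rot n hn A Γ q₁ hq₁symm hinv f m, key _ (by omega)]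
  congr 3
  ext i
  exact key _ (by omega)

/-- Concatenation `(a₀,…,a_{k-1},b₀,…,b_{n-2-k},c)`. -/
def catc (n k : ℕ) {A : Type} (a b : ℕ → A) (c : A) : ℕ → A := fun j =>
  if j < k then a j else if j < n - 1 then b (j - k) else c

lemma pair_pure (n p : ℕ) (hn : 3 ≤ n) (hp : p = n - 2) (hp0 : 0 < p)
    (A : Type) [AddCommGroup A] [Module ℂ A]
    (Γ : MultilinearMap ℂ (fun _ : Fin (n - 1) => A) A)
    (q₁ : A →ₗ[ℂ] A →ₗ[ℂ] ℂ)
    (mul : Mspace p A →ₗ[ℂ] Mspace p A →ₗ[ℂ] Mspace p A)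
    (hmul : MulSpec n p A Γ mul) (k l : Fin p) (hkl : k.1 + l.1 + 1 = p) (a b : ℕ → A) (c : A) :
    q₁ (piA p hp0 A (mul (incl p A k (tp A (k.1 + 1) a)) (incl p A l (tp A (l.1 + 1) b)))) c =
      q₁ (Γ (fun j : Fin (n - 1) => catc n (k.1 + 1) a b c j.1))
        (catc n (k.1 + 1) a b c (n - 1)) := by
  rw [mul_pure n p hn hp hp0 A Γ mul hmul k l hkl, piA_iotaA]
  have e : catc n (k.1 + 1) a b c (n - 1) = c := by
    unfold catc
    rw [if_neg (by omega), if_neg (by omega)]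
  rw [e]
  congr 3
  ext j
  simp [catc]

/-- For each `2 ≤ k ≤ p`, the set
`I_k = {a ∈ A₁^{⊗k} : a·b = 0 for all b ∈ A₁^{⊗(p+1−k)}}` coincides with the set
`{a ∈ A₁^{⊗k} : b·a = 0 for all b ∈ A₁^{⊗(p+1−k)}}`.  (Here the component of index
`k : Fin p` has degree `k + 1`, so the condition `2 ≤ degree` reads `1 ≤ k.1`.) -/
theorem right_annihilator_eq_left_annihilator
    (n p : ℕ) (hn : 3 ≤ n) (hp : p = n - 2)
    (A : Type) [AddCommGroup A] [Module ℂ A] [FiniteDimensional ℂ A]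
    (Γ : MultilinearMap ℂ (fun _ : Fin (n - 1) => A) A)
    (q₁ : A →ₗ[ℂ] A →ₗ[ℂ] ℂ)
    (hq₁symm : ∀ x y : A, q₁ x y = q₁ y x)
    (hq₁nondeg : ∀ x : A, (∀ y : A, q₁ x y = 0) → x = 0)
    (hinv : ∀ a : ℕ → A,
      q₁ (Γ (fun i : Fin (n - 1) => a i.1)) (a (n - 1)) =
        q₁ (a 0) (Γ (fun i : Fin (n - 1) => a (i.1 + 1))))
    (hassoc : ∀ r s : ℕ, r ≤ n - 2 → s ≤ n - 2 → ∀ a : ℕ → A,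
      gammaIns n A Γ r a = gammaIns n A Γ s a)
    (mul : Mspace p A →ₗ[ℂ] Mspace p A →ₗ[ℂ] Mspace p A)
    (hmul : MulSpec n p A Γ mul)
    :
    ∀ k : Fin p, 1 ≤ k.1 →
      {x : ⨂[ℂ]^(k.1 + 1) A |
        ∀ y : ⨂[ℂ]^(p - (k.1 + 1) + 1) A,
          mul (incl p A k x) (incl p A ⟨p - (k.1 + 1), by have := k.isLt; omega⟩ y) = 0} =
      {x : ⨂[ℂ]^(k.1 + 1) A |
        ∀ y : ⨂[ℂ]^(p - (k.1 + 1) + 1) A,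
          mul (incl p A ⟨p - (k.1 + 1), by have := k.isLt; omega⟩ y) (incl p A k x) = 0} := by
  intro k hk
  have hp0 : 0 < p := by omega
  obtain ⟨l, hl⟩ : ∃ l : Fin p, l = ⟨p - (k.1 + 1), by have := k.isLt; omega⟩ := ⟨_, rfl⟩
  have hkl : k.1 + l.1 + 1 = p := by rw [hl]; simp only; omega
  suffices H : {x : ⨂[ℂ]^(k.1 + 1) A |
        ∀ y : ⨂[ℂ]^(l.1 + 1) A, mul (incl p A k x) (incl p A l y) = 0} =
      {x : ⨂[ℂ]^(k.1 + 1) A |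
        ∀ y : ⨂[ℂ]^(l.1 + 1) A, mul (incl p A l y) (incl p A k x) = 0} by
    subst hl
    exact H
  clear hl
  ext x
  simp only [Set.mem_ofPred_eq]
  constructor
  · intro hx y
    refine lin_ext A _ _ ((mul.flip (incl p A k x)).comp (incl p A l)) 0 ?_ y
    intro b
    simp only [LinearMap.comp_apply, LinearMap.flip_apply, LinearMap.zero_apply]
    rw [mul_iota_pi n p hn hp hp0 A Γ mul hmul l k (by omega)]
    refine (congrArg _ (hq₁nondeg _ ?_)).trans (map_zero _)
    intro c
    have := lin_ext A ℂ _
      ((q₁.flip c).comp ((piA p hp0 A).comp ((mul (incl p A l (tp A _ b))).comp (incl p A k))))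
      ((q₁.flip (b l.1)).comp ((piA p hp0 A).comp ((mul.flip (incl p A l
        (tp A _ (fun i => if i = 0 then c else b (i - 1))))).comp (incl p A k)))) ?_ x
    · simp only [LinearMap.comp_apply, LinearMap.flip_apply] at this
      rw [this, hx]
      simp
    · intro a
      simp only [LinearMap.comp_apply, LinearMap.flip_apply]
      rw [pair_pure n p hn hp hp0 A Γ q₁ mul hmul l k (by omega),
        pair_pure n p hn hp hp0 A Γ q₁ mul hmul k l (by omega)]
      apply rot' n hn A Γ q₁ hq₁symm hinv _ _ (l.1 + 1) (by omega)
      · intro i hi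
        unfold catc
        grind
      · intro i hi hi2
        unfold catc
        grind
  · intro hx y
    refine lin_ext A _ _ ((mul (incl p A k x)).comp (incl p A l)) 0 ?_ y
    intro b
    simp only [LinearMap.comp_apply, LinearMap.zero_apply]
    rw [mul_iota_pi n p hn hp hp0 A Γ mul hmul k l (by omega)]
    refine (congrArg _ (hq₁nondeg _ ?_)).trans (map_zero _)
    intro c
    have := lin_ext A ℂ _
      ((q₁.flip c).comp ((piA p hp0 A).comp ((mul.flip (incl p A l (tp A _ b))).comp (incl p A k))))
      ((q₁.flip (b 0)).comp ((piA p hp0 A).comp ((mul (incl p A l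
        (tp A _ (fun i => if i < l.1 then b (i + 1) else c)))).comp (incl p A k)))) ?_ x
    · simp only [LinearMap.comp_apply, LinearMap.flip_apply] at this
      rw [this, hx]
      simp
    · intro a
      simp only [LinearMap.comp_apply, LinearMap.flip_apply]
      rw [pair_pure n p hn hp hp0 A Γ q₁ mul hmul l k (by omega),
        pair_pure n p hn hp hp0 A Γ q₁ mul hmul k l (by omega)]
      apply rot' n hn A Γ q₁ hq₁symm hinv _ _ (k.1 + 2) (by omega)
      · intro i hi
        unfold catc
        grind
      · intro i hi hi2
        unfold catc
        grind
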